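/- arXiv:0805.2316 — 2 statements merged into one kernel-verified Lean document; each statement's English description precedes it below -/
import Mathlib

section
/- For any real numbers y_ij (i = 1,…,k, j = 1,…,n_i with n_i ≥ 2, k ≥ 2) and n = Σ_{i=1}^k n_i, the pooled U-statistic satisfies U_n^0 = W_n + B_n, where W_n = Σ_{i=1}^k (n_i/n) U_i and B_n = Σ_{1≤i<i'≤k} [n_i n_{i'}/(n(n−1))] (2U_{ii'} − U_i − U_{i'}), with U_n^0 = (n choose 2)^{-1} Σ over all unordered pairs of distinct observations (y_r − y_s)²/2, U_i = (n_i choose 2)^{-1} Σ_{1≤j<j'≤n_i} (y_ij − y_ij')²/2 and U_{ii'} = (n_i n_{i'})^{-1} Σ_j Σ_{j'} (y_ij − y_{i'j'})²/2. -/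
open Finset

noncomputable section

/-- Cumulative sample sizes: `csum n i = n 0 + ⋯ + n (i-1)`, the number of observations
preceding treatment `i` in the lexicographic ordering (so `csum n k` is the total `n`). -/
def csum (n : ℕ → ℕ) (i : ℕ) : ℕ := ∑ i' ∈ Finset.range i, n i'

/-- The within-treatment U-statistic `U_i` computed from the lexicographically ordered
observations `x`: `U_i = (n_i choose 2)⁻¹ Σ_{j<j'} (x_{ij} - x_{ij'})²/2`, where
`x_{ij} = x (csum n i + j)`. -/
def Uw (n : ℕ → ℕ) (x : ℕ → ℝ) (i : ℕ) : ℝ :=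
  (((n i).choose 2 : ℝ))⁻¹ *
    ∑ j ∈ Finset.range (n i), ∑ j' ∈ (Finset.range (n i)).filter (fun j' => j < j'),
      (x (csum n i + j) - x (csum n i + j')) ^ 2 / 2

/-- The generalized between-treatment U-statistic of order (1,1):
`U_{ii'} = (n_i n_{i'})⁻¹ Σ_j Σ_{j'} (x_{ij} - x_{i'j'})²/2`. -/
def Ub (n : ℕ → ℕ) (x : ℕ → ℝ) (i i' : ℕ) : ℝ :=
  ((n i : ℝ) * (n i' : ℝ))⁻¹ *
    ∑ j ∈ Finset.range (n i), ∑ j' ∈ Finset.range (n i'),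
      (x (csum n i + j) - x (csum n i' + j')) ^ 2 / 2

/-- The pooled U-statistic over all `n = csum n k` observations:
`U_n⁰ = (n choose 2)⁻¹ Σ_{r<s} (x_r - x_s)²/2`. -/
def U0 (n : ℕ → ℕ) (k : ℕ) (x : ℕ → ℝ) : ℝ :=
  (((csum n k).choose 2 : ℝ))⁻¹ *
    ∑ r ∈ Finset.range (csum n k), ∑ s ∈ (Finset.range (csum n k)).filter (fun s => r < s),
      (x r - x s) ^ 2 / 2

/-- The within-treatments component `W_n = Σ_i (n_i/n) U_i`. -/
def Wstat (n : ℕ → ℕ) (k : ℕ) (x : ℕ → ℝ) : ℝ :=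
  ∑ i ∈ Finset.range k, ((n i : ℝ) / (csum n k : ℝ)) * Uw n x i

/-- The between-treatments component
`B_n = Σ_{i<i'} [n_i n_{i'}/(n(n-1))] (2 U_{ii'} - U_i - U_{i'})`. -/
def Bstat (n : ℕ → ℕ) (k : ℕ) (x : ℕ → ℝ) : ℝ :=
  ∑ i ∈ Finset.range k, ∑ i' ∈ (Finset.range k).filter (fun i' => i < i'),
    ((n i : ℝ) * (n i' : ℝ) / ((csum n k : ℝ) * ((csum n k : ℝ) - 1))) *
      (2 * Ub n x i i' - Uw n x i - Uw n x i')

theorem sum_lt_aux (f : ℕ → ℕ → ℝ) (hf : ∀ a b, f a b = f b a) (N : ℕ) :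
    2 * (∑ r ∈ Finset.range N, ∑ s ∈ (Finset.range N).filter (fun s => r < s), f r s)
      + ∑ r ∈ Finset.range N, f r r = ∑ r ∈ Finset.range N, ∑ s ∈ Finset.range N, f r s := by
  simp only [Finset.sum_filter]
  induction N with
  | zero => simp
  | succ N ih =>
    simp only [Finset.sum_range_succ, Finset.sum_add_distrib]
    have h1 : ∑ r ∈ Finset.range N, (if r < N then f r N else 0)
        = ∑ r ∈ Finset.range N, f r N :=
      Finset.sum_congr rfl (fun r hr => by simp [Finset.mem_range.1 hr])
    have h2 : ∑ s ∈ Finset.range N, (if N < s then f N s else 0) = 0 :=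
      Finset.sum_eq_zero (fun s hs => by
        have := Finset.mem_range.1 hs
        rw [if_neg (by omega)])
    have h3 : ∑ s ∈ Finset.range N, f N s = ∑ r ∈ Finset.range N, f r N :=
      Finset.sum_congr rfl (fun r _ => hf _ _)
    rw [h1, h2, h3, ← ih]
    simp
    ring

theorem sum_csum_aux (n : ℕ → ℕ) (f : ℕ → ℝ) (k : ℕ) :
    ∑ r ∈ Finset.range (csum n k), f r
      = ∑ i ∈ Finset.range k, ∑ j ∈ Finset.range (n i), f (csum n i + j) := by
  induction k with
  | zero => simp [csum]
  | succ k ih =>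
    have : csum n (k+1) = csum n k + n k := by simp [csum, Finset.sum_range_succ]
    rw [this, Finset.sum_range_add, ih, Finset.sum_range_succ]

/-- Block sums of the kernel. -/
def Sblk (n : ℕ → ℕ) (x : ℕ → ℝ) (i i' : ℕ) : ℝ :=
  ∑ j ∈ Finset.range (n i), ∑ j' ∈ Finset.range (n i'),
      (x (csum n i + j) - x (csum n i' + j')) ^ 2 / 2

theorem Sblk_symm (n : ℕ → ℕ) (x : ℕ → ℝ) (i i' : ℕ) : Sblk n x i i' = Sblk n x i' i := by
  unfold Sblk
  rw [Finset.sum_comm]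
  exact Finset.sum_congr rfl (fun _ _ => Finset.sum_congr rfl (fun _ _ => by ring))

theorem Uw_aux (n : ℕ → ℕ) (x : ℕ → ℝ) (i : ℕ) (h : 2 ≤ n i) :
    (n i : ℝ) * ((n i : ℝ) - 1) * Uw n x i = Sblk n x i i := by
  have h2 : (2 : ℝ) ≤ n i := by exact_mod_cast h
  have h3 : (n i : ℝ) ≠ 0 := by linarith
  have h4 : (n i : ℝ) - 1 ≠ 0 := by linarith
  have := sum_lt_aux (fun j j' => (x (csum n i + j) - x (csum n i + j')) ^ 2 / 2)
    (fun a b => by ring) (n i)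
  simp only [sub_self] at this
  unfold Uw Sblk
  rw [← this, Nat.cast_choose_two]
  field_simp
  simp

theorem U0_aux (n : ℕ → ℕ) (k : ℕ) (x : ℕ → ℝ) (h : 2 ≤ csum n k) :
    (csum n k : ℝ) * ((csum n k : ℝ) - 1) * U0 n k x
      = ∑ i ∈ Finset.range k, ∑ i' ∈ Finset.range k, Sblk n x i i' := by
  have h2 : (2 : ℝ) ≤ csum n k := by exact_mod_cast h
  have h3 : (csum n k : ℝ) ≠ 0 := by linarith
  have h4 : (csum n k : ℝ) - 1 ≠ 0 := by linarith
  have := sum_lt_aux (fun j j' => (x j - x j') ^ 2 / 2) (fun a b => by ring) (csum n k)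
  simp only [sub_self] at this
  have e : ∑ i ∈ Finset.range k, ∑ i' ∈ Finset.range k, Sblk n x i i'
      = ∑ r ∈ Finset.range (csum n k), ∑ s ∈ Finset.range (csum n k), (x r - x s) ^ 2 / 2 := by
    rw [sum_csum_aux]
    refine Finset.sum_congr rfl (fun i _ => ?_)
    simp only [Sblk, sum_csum_aux n _ k]
    rw [Finset.sum_comm]
  unfold U0
  rw [e, ← this, Nat.cast_choose_two]
  field_simp
  simp

/-- decomposition (2.4): for any real observations arranged
lexicographically, the pooled U-statistic splits into within- and between-treatments
components: `U_n⁰ = W_n + B_n`. -/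
theorem pooled_ustat_within_between (k : ℕ) (hk : 2 ≤ k) (n : ℕ → ℕ)
    (hn : ∀ i < k, 2 ≤ n i) (x : ℕ → ℝ) :
    U0 n k x = Wstat n k x + Bstat n k x := by
  have hN : 2 ≤ csum n k := by
    have h0 : n 0 ≤ csum n k :=
      Finset.single_le_sum (f := n) (fun _ _ => Nat.zero_le _) (Finset.mem_range.2 (by omega))
    have := hn 0 (by omega)
    omega
  have h2 : (2 : ℝ) ≤ csum n k := by exact_mod_cast hN
  have h3 : (csum n k : ℝ) ≠ 0 := by linarith
  have h4 : (csum n k : ℝ) - 1 ≠ 0 := by linarith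
  have hU := U0_aux n k x hN
  have hB : (csum n k : ℝ) * ((csum n k : ℝ) - 1) * Bstat n k x
      = ∑ i ∈ Finset.range k, ∑ i' ∈ (Finset.range k).filter (fun i' => i < i'),
        (2 * Sblk n x i i' - (n i : ℝ) * n i' * (Uw n x i + Uw n x i')) := by
    unfold Bstat
    rw [Finset.mul_sum]
    refine Finset.sum_congr rfl (fun i hi => ?_)
    rw [Finset.mul_sum]
    refine Finset.sum_congr rfl (fun i' hi' => ?_)
    have a1 : (2 : ℝ) ≤ n i := by exact_mod_cast hn i (Finset.mem_range.1 hi)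
    have a2 : (2 : ℝ) ≤ n i' := by
      exact_mod_cast hn i' (Finset.mem_range.1 (Finset.mem_filter.1 hi').1)
    have a3 : (n i : ℝ) ≠ 0 := by linarith
    have a4 : (n i' : ℝ) ≠ 0 := by linarith
    have e : Ub n x i i' = ((n i : ℝ) * (n i' : ℝ))⁻¹ * Sblk n x i i' := rfl
    rw [e]
    field_simp
    ring
  have hW : (csum n k : ℝ) * Wstat n k x = ∑ i ∈ Finset.range k, (n i : ℝ) * Uw n x i := by
    unfold Wstat
    rw [Finset.mul_sum]
    refine Finset.sum_congr rfl (fun i _ => ?_)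
    field_simp
  have hs := sum_lt_aux
    (fun i i' => 2 * Sblk n x i i' - (n i : ℝ) * n i' * (Uw n x i + Uw n x i'))
    (fun a b => by simp only [Sblk_symm n x a b]; ring) k
  rw [← hB] at hs
  have hd : ∑ i ∈ Finset.range k,
      (2 * Sblk n x i i - (n i : ℝ) * n i * (Uw n x i + Uw n x i))
      = -2 * ∑ i ∈ Finset.range k, (n i : ℝ) * Uw n x i := by
    rw [Finset.mul_sum]
    refine Finset.sum_congr rfl (fun i hi => ?_)
    rw [← Uw_aux n x i (hn i (Finset.mem_range.1 hi))]
    ring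
  have hc : (csum n k : ℝ) = ∑ i ∈ Finset.range k, (n i : ℝ) := by simp [csum]
  have hf : ∑ i ∈ Finset.range k, ∑ i' ∈ Finset.range k,
      (2 * Sblk n x i i' - (n i : ℝ) * n i' * (Uw n x i + Uw n x i'))
      = 2 * (∑ i ∈ Finset.range k, ∑ i' ∈ Finset.range k, Sblk n x i i')
        - 2 * ((csum n k : ℝ) * ∑ i ∈ Finset.range k, (n i : ℝ) * Uw n x i) := by
    have p1 : ∑ i ∈ Finset.range k, ∑ i' ∈ Finset.range k, (n i : ℝ) * ((n i' : ℝ) * Uw n x i')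
        = (csum n k : ℝ) * ∑ i ∈ Finset.range k, (n i : ℝ) * Uw n x i := by
      rw [hc, Finset.sum_mul_sum]
    have p2 : ∑ i ∈ Finset.range k, ∑ i' ∈ Finset.range k, (n i' : ℝ) * ((n i : ℝ) * Uw n x i)
        = (csum n k : ℝ) * ∑ i ∈ Finset.range k, (n i : ℝ) * Uw n x i := by
      rw [Finset.sum_comm, hc, Finset.sum_mul_sum]
    have : ∀ i i', 2 * Sblk n x i i' - (n i : ℝ) * n i' * (Uw n x i + Uw n x i')
        = 2 * Sblk n x i i' - (n i : ℝ) * ((n i' : ℝ) * Uw n x i')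
          - (n i' : ℝ) * ((n i : ℝ) * Uw n x i) := fun i i' => by ring
    have p3 : ∑ i ∈ Finset.range k, ∑ i' ∈ Finset.range k, 2 * Sblk n x i i'
        = 2 * ∑ i ∈ Finset.range k, ∑ i' ∈ Finset.range k, Sblk n x i i' := by
      simp only [Finset.mul_sum]
    simp only [this, Finset.sum_sub_distrib]
    rw [p1, p2, p3]
    ring
  rw [hd, hf, ← hU, ← hW] at hs
  have h5 : (csum n k : ℝ) * ((csum n k : ℝ) - 1) ≠ 0 := mul_ne_zero h3 h4
  apply mul_left_cancel₀ h5
  linarith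
end
end

section
/- For any real numbers y_ij (i = 1,…,k, j = 1,…,n_i with n_i ≥ 2, k ≥ 2), n = Σ n_i, and any real constant μ, the between-treatments statistic B_n = Σ_{1≤i<i'≤k} [n_i n_{i'}/(n(n−1))] (2U_{ii'} − U_i − U_{i'}) admits the representation B_n = (n choose 2)^{-1} Σ_{1≤r<s≤n} η_rs (y_r − μ)(y_s − μ), where the observations are indexed lexicographically as y_1,…,y_n and η_rs = (n − n_i)/(n_i − 1) if y_r and y_s are both observed under the i-th treatment, η_rs = −1 otherwise. -/
open Finset

noncomputable section

/-- The treatment to which the lexicographic position `r` belongs: the unique `i` with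
`csum n i ≤ r < csum n (i+1)`. -/
def trt (n : ℕ → ℕ) (r : ℕ) : ℕ := sInf {i : ℕ | r < csum n (i + 1)}

/-- The weights of representation (2.5): `η_{rs} = (n - n_i)/(n_i - 1)` if positions `r` and
`s` both belong to treatment `i`, and `η_{rs} = -1` otherwise. -/
def eta (n : ℕ → ℕ) (k : ℕ) (r s : ℕ) : ℝ :=
  if trt n r = trt n s then
    ((csum n k : ℝ) - (n (trt n r) : ℝ)) / ((n (trt n r) : ℝ) - 1)
  else -1

theorem csum_mono (n : ℕ → ℕ) : Monotone (csum n) := by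
  apply monotone_nat_of_le_succ
  intro i
  simp [csum, Finset.sum_range_succ]

theorem trt_eq (n : ℕ → ℕ) (i j : ℕ) (hj : j < n i) : trt n (csum n i + j) = i := by
  unfold trt
  have hmem : i ∈ {l : ℕ | csum n i + j < csum n (l + 1)} := by
    simp only [Set.mem_setOf_eq]
    have : csum n (i + 1) = csum n i + n i := by simp [csum, Finset.sum_range_succ]
    omega
  apply le_antisymm
  · exact Nat.sInf_le hmem
  · apply le_csInf ⟨i, hmem⟩
    intro l hl
    simp only [Set.mem_setOf_eq] at hl
    by_contra hlt
    have := csum_mono n (show l + 1 ≤ i by omega)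
    omega

theorem sum_range_csum (n : ℕ → ℕ) (k : ℕ) (f : ℕ → ℝ) :
    ∑ r ∈ Finset.range (csum n k), f r
      = ∑ i ∈ Finset.range k, ∑ j ∈ Finset.range (n i), f (csum n i + j) := by
  induction k with
  | zero => simp [csum]
  | succ k ih =>
    have : csum n (k + 1) = csum n k + n k := by simp [csum, Finset.sum_range_succ]
    rw [this, Finset.sum_range_add, ih, Finset.sum_range_succ]

theorem sum_lt_symm (m : ℕ) (f : ℕ → ℕ → ℝ) (hf : ∀ a b, f a b = f b a) :
    ∑ r ∈ Finset.range m, ∑ s ∈ (Finset.range m).filter (fun s => r < s), f r s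
      = (∑ r ∈ Finset.range m, ∑ s ∈ Finset.range m, f r s
          - ∑ r ∈ Finset.range m, f r r) / 2 := by
  have h1 : ∑ r ∈ Finset.range m, ∑ s ∈ Finset.range m, f r s
      = ∑ r ∈ Finset.range m, ∑ s ∈ Finset.range m, (if r < s then f r s else 0)
        + ∑ r ∈ Finset.range m, ∑ s ∈ Finset.range m, (if s < r then f r s else 0)
        + ∑ r ∈ Finset.range m, ∑ s ∈ Finset.range m, (if r = s then f r s else 0) := by
    simp only [← Finset.sum_add_distrib]
    refine Finset.sum_congr rfl fun r _ => Finset.sum_congr rfl fun s _ => ?_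
    rcases lt_trichotomy r s with h | h | h
    · simp [h, h.ne, h.le]
    · simp [h]
    · simp [h, h.ne', h.le]
  have h2 : ∑ r ∈ Finset.range m, ∑ s ∈ Finset.range m, (if s < r then f r s else 0)
      = ∑ r ∈ Finset.range m, ∑ s ∈ Finset.range m, (if r < s then f r s else 0) := by
    rw [Finset.sum_comm]
    refine Finset.sum_congr rfl fun r _ => Finset.sum_congr rfl fun s _ => ?_
    rw [hf]
  have h3 : ∑ r ∈ Finset.range m, ∑ s ∈ Finset.range m, (if r = s then f r s else 0)
      = ∑ r ∈ Finset.range m, f r r := by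
    refine Finset.sum_congr rfl fun r hr => ?_
    rw [Finset.sum_ite_eq, if_pos hr]
  simp only [Finset.sum_filter]
  rw [h1, h2, h3]
  ring

theorem sum_sq_diff (a b : ℕ) (f g : ℕ → ℝ) (c : ℝ) :
    ∑ j ∈ Finset.range a, ∑ j' ∈ Finset.range b, (f j - g j') ^ 2 / 2
      = ((b : ℝ) * ∑ j ∈ Finset.range a, (f j - c) ^ 2
          + (a : ℝ) * ∑ j ∈ Finset.range b, (g j - c) ^ 2
          - 2 * ((∑ j ∈ Finset.range a, (f j - c)) * ∑ j ∈ Finset.range b, (g j - c))) / 2 := by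
  have h : ∀ j j', (f j - g j') ^ 2 / 2
      = (f j - c) ^ 2 / 2 + (g j' - c) ^ 2 / 2 - (f j - c) * (g j' - c) := by
    intro j j'; ring
  simp only [h, Finset.sum_sub_distrib, Finset.sum_add_distrib, ← Finset.mul_sum,
    ← Finset.sum_mul, Finset.sum_const, Finset.card_range, nsmul_eq_mul, ← Finset.sum_div]
  ring

/-- centred block sum -/
def SS (n : ℕ → ℕ) (x : ℕ → ℝ) (c : ℝ) (i : ℕ) : ℝ :=
  ∑ j ∈ Finset.range (n i), (x (csum n i + j) - c)

/-- centred block sum of squares -/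
def QQ (n : ℕ → ℕ) (x : ℕ → ℝ) (c : ℝ) (i : ℕ) : ℝ :=
  ∑ j ∈ Finset.range (n i), (x (csum n i + j) - c) ^ 2

theorem Uw_eq (n : ℕ → ℕ) (x : ℕ → ℝ) (c : ℝ) (i : ℕ) :
    Uw n x i = ((n i : ℝ) * QQ n x c i - SS n x c i ^ 2) / ((n i : ℝ) * ((n i : ℝ) - 1)) := by
  unfold Uw
  rw [sum_lt_symm (n i) (fun j j' => (x (csum n i + j) - x (csum n i + j')) ^ 2 / 2)
    (fun a b => by ring)]
  rw [sum_sq_diff (n i) (n i) (fun j => x (csum n i + j)) (fun j => x (csum n i + j)) c,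
    Nat.cast_choose_two]
  simp only [sub_self]
  unfold SS QQ
  rw [inv_div]
  simp
  ring

theorem Ub_eq (n : ℕ → ℕ) (x : ℕ → ℝ) (c : ℝ) (i i' : ℕ) (hi : (n i : ℝ) ≠ 0)
    (hi' : (n i' : ℝ) ≠ 0) :
    (n i : ℝ) * (n i' : ℝ) * (2 * Ub n x i i')
      = (n i' : ℝ) * QQ n x c i + (n i : ℝ) * QQ n x c i' - 2 * (SS n x c i * SS n x c i') := by
  unfold Ub
  rw [sum_sq_diff (n i) (n i') (fun j => x (csum n i + j)) (fun j => x (csum n i' + j)) c]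
  unfold SS QQ
  field_simp

theorem eta_symm (n : ℕ → ℕ) (k r s : ℕ) : eta n k r s = eta n k s r := by
  unfold eta
  by_cases h : trt n r = trt n s
  · simp [h]
  · simp [h, Ne.symm h]

theorem Bstat_eq (k : ℕ) (n : ℕ → ℕ) (hn : ∀ i < k, 2 ≤ n i) (x : ℕ → ℝ) (c : ℝ) :
    Bstat n k x = (1 / ((csum n k : ℝ) * ((csum n k : ℝ) - 1))) *
      (∑ i ∈ Finset.range k, ((csum n k : ℝ) - n i) * (SS n x c i ^ 2 - QQ n x c i) / (n i - 1)
        - (∑ i ∈ Finset.range k, SS n x c i) ^ 2 + ∑ i ∈ Finset.range k, SS n x c i ^ 2) := by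
  set N : ℝ := (csum n k : ℝ) with hN
  have hNs : N = ∑ i ∈ Finset.range k, (n i : ℝ) := by simp [hN, csum]
  set D : ℕ → ℕ → ℝ := fun i i' =>
    (n i' : ℝ) * QQ n x c i + (n i : ℝ) * QQ n x c i' - 2 * (SS n x c i * SS n x c i')
      - (n i : ℝ) * n i' * Uw n x i - n i * n i' * Uw n x i' with hD
  have hB : Bstat n k x = (1 / (N * (N - 1))) *
      ∑ i ∈ Finset.range k, ∑ i' ∈ (Finset.range k).filter (fun i' => i < i'), D i i' := by
    unfold Bstat
    simp only [Finset.mul_sum]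
    refine Finset.sum_congr rfl fun i hi => Finset.sum_congr rfl fun i' hi' => ?_
    have h1 := hn i (Finset.mem_range.1 hi)
    have h2 := hn i' (Finset.mem_range.1 (Finset.mem_filter.1 hi').1)
    have := Ub_eq n x c i i' (by positivity) (by positivity)
    simp only [hD]
    rw [← this]
    ring
  rw [hB, sum_lt_symm k D (fun a b => by simp only [hD]; ring)]
  congr 1
  have hDD : ∑ i ∈ Finset.range k, ∑ i' ∈ Finset.range k, D i i'
      = 2 * N * ∑ i ∈ Finset.range k, QQ n x c i - 2 * (∑ i ∈ Finset.range k, SS n x c i) ^ 2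
        - 2 * N * ∑ i ∈ Finset.range k, n i * Uw n x i := by
    have e : ∀ i i', D i i' = (n i' : ℝ) * QQ n x c i + (n i : ℝ) * QQ n x c i'
      - 2 * (SS n x c i * SS n x c i')
      - (n i' : ℝ) * (n i * Uw n x i) - n i * (n i' * Uw n x i') := by
      intro i i'; simp only [hD]; ring
    simp only [e, Finset.sum_sub_distrib, Finset.sum_add_distrib, ← Finset.mul_sum,
      ← Finset.sum_mul, ← hNs]
    ring
  have key : N * ∑ i ∈ Finset.range k, QQ n x c i - N * ∑ i ∈ Finset.range k, n i * Uw n x i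
      - (∑ i ∈ Finset.range k, D i i) / 2
      = ∑ i ∈ Finset.range k, (N - n i) * (SS n x c i ^ 2 - QQ n x c i) / (n i - 1)
        + ∑ i ∈ Finset.range k, SS n x c i ^ 2 := by
    rw [Finset.mul_sum, Finset.mul_sum, Finset.sum_div, ← Finset.sum_sub_distrib,
      ← Finset.sum_sub_distrib, ← Finset.sum_add_distrib]
    refine Finset.sum_congr rfl fun i hi => ?_
    have h1 : (2 : ℝ) ≤ n i := by exact_mod_cast hn i (Finset.mem_range.1 hi)
    have h2 : (n i : ℝ) ≠ 0 := by linarith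
    have h3 : (n i : ℝ) - 1 ≠ 0 := by linarith
    simp only [hD, Uw_eq n x c i]
    field_simp
    ring
  rw [hDD]
  linarith

/-- representation (2.5): for any real observations `x` arranged
lexicographically and any real `μ`, the between-treatments statistic admits the
representation `B_n = (n choose 2)⁻¹ Σ_{r<s} η_{rs} (x_r - μ)(x_s - μ)`. -/
theorem between_stat_representation (k : ℕ) (hk : 2 ≤ k) (n : ℕ → ℕ)
    (hn : ∀ i < k, 2 ≤ n i) (x : ℕ → ℝ) (μc : ℝ) :
    Bstat n k x
      = (((csum n k).choose 2 : ℝ))⁻¹ *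
          ∑ r ∈ Finset.range (csum n k),
            ∑ s ∈ (Finset.range (csum n k)).filter (fun s => r < s),
              eta n k r s * ((x r - μc) * (x s - μc)) := by
  rw [Bstat_eq k n hn x μc, sum_lt_symm _ (fun r s => eta n k r s * ((x r - μc) * (x s - μc)))
    (fun a b => by rw [eta_symm]; ring), Nat.cast_choose_two, inv_div]
  have hdiag : ∑ r ∈ Finset.range (csum n k), eta n k r r * ((x r - μc) * (x r - μc))
      = ∑ i ∈ Finset.range k, ((csum n k : ℝ) - n i) / (n i - 1) * QQ n x μc i := by
    rw [sum_range_csum]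
    refine Finset.sum_congr rfl fun i hi => ?_
    rw [QQ, Finset.mul_sum]
    refine Finset.sum_congr rfl fun j hj => ?_
    simp only [eta, trt_eq n i j (Finset.mem_range.1 hj), if_true]
    ring
  have hall : ∑ r ∈ Finset.range (csum n k), ∑ s ∈ Finset.range (csum n k),
        eta n k r s * ((x r - μc) * (x s - μc))
      = ∑ i ∈ Finset.range k, ∑ i' ∈ Finset.range k,
        ((if i = i' then (((csum n k : ℝ) - n i) / (n i - 1) + 1)
          * (SS n x μc i * SS n x μc i') else 0) - SS n x μc i * SS n x μc i') := by
    rw [sum_range_csum]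
    refine Finset.sum_congr rfl fun i hi => ?_
    simp only [sum_range_csum n k]
    rw [Finset.sum_comm]
    refine Finset.sum_congr rfl fun i' hi' => ?_
    have : ((if i = i' then (((csum n k : ℝ) - n i) / (n i - 1) + 1)
          * (SS n x μc i * SS n x μc i') else 0) - SS n x μc i * SS n x μc i')
        = (if i = i' then ((csum n k : ℝ) - n i) / (n i - 1) else -1)
          * (SS n x μc i * SS n x μc i') := by
      split_ifs <;> ring
    rw [this, SS, SS, Finset.sum_mul_sum, Finset.mul_sum]
    refine Finset.sum_congr rfl fun j hj => ?_
    rw [Finset.mul_sum]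
    refine Finset.sum_congr rfl fun j' hj' => ?_
    simp only [eta, trt_eq n i j (Finset.mem_range.1 hj),
      trt_eq n i' j' (Finset.mem_range.1 hj')]
  have hall2 : ∑ i ∈ Finset.range k, ∑ i' ∈ Finset.range k,
        ((if i = i' then (((csum n k : ℝ) - n i) / (n i - 1) + 1)
          * (SS n x μc i * SS n x μc i') else 0) - SS n x μc i * SS n x μc i')
      = ∑ i ∈ Finset.range k, (((csum n k : ℝ) - n i) / (n i - 1) + 1) * SS n x μc i ^ 2
        - (∑ i ∈ Finset.range k, SS n x μc i) ^ 2 := by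
    simp only [Finset.sum_sub_distrib]
    congr 1
    · refine Finset.sum_congr rfl fun i hi => ?_
      rw [Finset.sum_ite_eq, if_pos hi]
      ring
    · rw [sq, Finset.sum_mul_sum]
  have hfin : ∑ i ∈ Finset.range k,
        ((csum n k : ℝ) - n i) * (SS n x μc i ^ 2 - QQ n x μc i) / (n i - 1)
        + ∑ i ∈ Finset.range k, SS n x μc i ^ 2
      = ∑ i ∈ Finset.range k, (((csum n k : ℝ) - n i) / (n i - 1) + 1) * SS n x μc i ^ 2
        - ∑ i ∈ Finset.range k, ((csum n k : ℝ) - n i) / (n i - 1) * QQ n x μc i := by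
    rw [← Finset.sum_add_distrib, ← Finset.sum_sub_distrib]
    refine Finset.sum_congr rfl fun i hi => ?_
    ring
  rw [hdiag, hall, hall2]
  rw [show ∀ a b c : ℝ, a - b + c = (a + c) - b from fun a b c => by ring, hfin]
  ring
end
end
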